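/- arXiv:1311.1838 — 4 statements merged into one kernel-verified Lean document; each statement's English description precedes it below -/
import Mathlib

section
/- Let r > 0, set κ = 1/r, and let 0 < d < r. In the Euclidean plane ℝ², let B be the closed ball of radius r centered at (0, −r), so that the point n = (0,0) lies on its boundary with unit tangent direction ū = (1,0). Then the two-dimensional Lebesgue measure of the set {p ∈ ℝ² : p ∈ B, ‖p − n‖ ≤ r, p + d·ū ∉ B, p − d·ū ∉ B} equals κ·d³/4 + O(d⁴) as d → 0⁺; that is, the function of d given by this measure minus κ·d³/4 is Big-O of d⁴ as d tends to 0 from the right. -/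
open MeasureTheory Asymptotics Filter

/-- The point `(x, y)` of the Euclidean plane `ℝ²`. -/
noncomputable def pt (x y : ℝ) : EuclideanSpace ℝ (Fin 2) :=
  (WithLp.equiv 2 (Fin 2 → ℝ)).symm ![x, y]

/-- The second-order expansion of `√(r² - u)` at `u = 0`, with an explicit one-sided remainder. -/
theorem sqrt_sq_sub_bounds {r u : ℝ} (hr : 0 < r) (hu : 0 ≤ u) (hur : u ≤ r ^ 2) :
    0 ≤ r - u / (2 * r) - √(r ^ 2 - u) ∧
      r - u / (2 * r) - √(r ^ 2 - u) ≤ u ^ 2 / (2 * r ^ 3) := by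
  have hs := Real.sqrt_nonneg (r ^ 2 - u)
  have hs2 := Real.sq_sqrt (sub_nonneg.2 hur)
  set s := √(r ^ 2 - u)
  have hus : u = r ^ 2 - s ^ 2 := by linarith
  clear_value s
  subst hus
  have key : r - (r ^ 2 - s ^ 2) / (2 * r) - s = (r - s) ^ 2 / (2 * r) := by
    field_simp
    ring
  rw [key]
  refine ⟨by positivity, ?_⟩
  rw [div_le_div_iff₀ (by positivity) (by positivity)]
  have h : r ^ 2 ≤ (r + s) ^ 2 := by nlinarith
  have := mul_le_mul_of_nonneg_left h (by positivity : 0 ≤ (r - s) ^ 2 * (2 * r))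
  nlinarith

/-- The points within `r` of the origin in the disc of radius `r` about `(0, -r)` both of whose
horizontal translates by `d` leave the disc, in coordinates. -/
def tripleRegion (r d : ℝ) : Set (ℝ × ℝ) :=
  {q | q.1 ^ 2 + (q.2 + r) ^ 2 ≤ r ^ 2 ∧ q.1 ^ 2 + q.2 ^ 2 ≤ r ^ 2 ∧
    r ^ 2 < (q.1 + d) ^ 2 + (q.2 + r) ^ 2 ∧ r ^ 2 < (q.1 - d) ^ 2 + (q.2 + r) ^ 2}

theorem measurableSet_tripleRegion (r d : ℝ) : MeasurableSet (tripleRegion r d) := by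
  unfold tripleRegion
  measurability

theorem norm_euclideanPlane_le_iff {r : ℝ} (hr : 0 < r) (v : EuclideanSpace ℝ (Fin 2)) :
    ‖v‖ ≤ r ↔ v 0 ^ 2 + v 1 ^ 2 ≤ r ^ 2 := by
  rw [EuclideanSpace.norm_eq, Real.sqrt_le_left hr.le]
  simp [Fin.sum_univ_two]

/-- The map `(x, y) ↦ pt x y` preserves area. -/
theorem measurePreserving_pt : MeasurePreserving (fun q : ℝ × ℝ => pt q.1 q.2) := by
  have h := (PiLp.volume_preserving_toLp (Fin 2)).comp
    (volume_preserving_finTwoArrow ℝ).symm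
  exact h

theorem volume_triple_set_eq {r : ℝ} (hr : 0 < r) (d : ℝ) :
    volume {p : EuclideanSpace ℝ (Fin 2) |
        p ∈ Metric.closedBall (pt 0 (-r)) r ∧
        ‖p - pt 0 0‖ ≤ r ∧
        p + d • pt 1 0 ∉ Metric.closedBall (pt 0 (-r)) r ∧
        p - d • pt 1 0 ∉ Metric.closedBall (pt 0 (-r)) r} = volume (tripleRegion r d) := by
  rw [← measurePreserving_pt.measure_preimage]
  · congr 1
    ext q
    simp [tripleRegion, pt, dist_eq_norm, norm_euclideanPlane_le_iff hr]
  · refine MeasurableSet.nullMeasurableSet ?_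
    refine Metric.isClosed_closedBall.measurableSet.inter (MeasurableSet.inter ?_
      (MeasurableSet.inter ?_ ?_))
    · exact (isClosed_le (f := fun p => ‖p - pt 0 0‖) (g := fun _ => r) (by fun_prop) (by fun_prop)).measurableSet
    · exact (Metric.isClosed_closedBall.preimage (by fun_prop)).measurableSet.compl
    · exact (Metric.isClosed_closedBall.preimage (by fun_prop)).measurableSet.compl

theorem tripleRegion_slice {r d : ℝ} (hd : 0 < d) (hdr : d < r / 2) (x : ℝ) :
    Prod.mk x ⁻¹' tripleRegion r d =
      if x ∈ Set.Ioc (-(d / 2)) (d / 2) then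
        Set.Ioc (√(r ^ 2 - (d - |x|) ^ 2) - r) (√(r ^ 2 - x ^ 2) - r) else ∅ := by
  have hr : 0 < r := by linarith
  ext y
  have habs : x ^ 2 = |x| ^ 2 := (sq_abs x).symm
  have hx0 := abs_nonneg x
  have hmem : y ∈ Prod.mk x ⁻¹' tripleRegion r d ↔ |x| ^ 2 + (y + r) ^ 2 ≤ r ^ 2 ∧
      |x| ^ 2 + y ^ 2 ≤ r ^ 2 ∧ r ^ 2 < (d - |x|) ^ 2 + (y + r) ^ 2 := by
    simp only [tripleRegion, Set.mem_preimage, Set.mem_ofPred_eq]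
    rcases abs_cases x with ⟨h, h'⟩ | ⟨h, h'⟩ <;> rw [h] <;> constructor
    · rintro ⟨a, b, c, e⟩
      exact ⟨a, b, by linarith⟩
    · rintro ⟨a, b, c⟩
      exact ⟨a, b, by nlinarith, by linarith⟩
    · rintro ⟨a, b, c, e⟩
      exact ⟨by linarith, by linarith, by linarith⟩
    · rintro ⟨a, b, c⟩
      exact ⟨by linarith, by linarith, by linarith, by nlinarith⟩
  rw [hmem]
  split_ifs with hx
  · have hxd : |x| ≤ d / 2 := abs_le.2 ⟨hx.1.le, hx.2⟩
    rw [Set.mem_Ioc, sub_lt_iff_lt_add, le_sub_iff_add_le, habs]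
    constructor
    · rintro ⟨a, b, c⟩
      have hy : 0 < y + r := by
        by_contra! h
        nlinarith
      exact ⟨(Real.sqrt_lt' hy).2 (by linarith), Real.le_sqrt_of_sq_le (by linarith)⟩
    · rintro ⟨a, b⟩
      have hy : 0 < y + r := (Real.sqrt_nonneg _).trans_lt a
      have a' := (Real.sqrt_lt' hy).1 a
      have b' := (Real.le_sqrt' hy).1 b
      refine ⟨by linarith, ?_, by linarith⟩
      have hyr : r / 2 ≤ y + r := by
        by_contra! h
        nlinarith
      nlinarith
  · simp only [Set.mem_empty_iff_false, iff_false]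
    rintro ⟨a, b, c⟩
    have hlt : |x| < d / 2 := by
      by_contra! h
      nlinarith
    exact hx ⟨(abs_lt.1 hlt).1, (abs_lt.1 hlt).2.le⟩

theorem sqrt_sub_sqrt_approx {r d x : ℝ} (hd : 0 < d) (hdr : d < r / 2)
    (hx : x ∈ Set.Ioc (-(d / 2)) (d / 2)) :
    |√(r ^ 2 - x ^ 2) - √(r ^ 2 - (d - |x|) ^ 2) - (d ^ 2 - 2 * d * |x|) / (2 * r)|
      ≤ d ^ 4 / (2 * r ^ 3) := by
  have hr : 0 < r := by linarith
  have hxd : |x| ≤ d / 2 := abs_le.2 ⟨hx.1.le, hx.2⟩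
  have hx0 := abs_nonneg x
  have h1 : x ^ 2 ≤ d ^ 2 := by rw [← sq_abs x]; gcongr; linarith
  have h2 : (d - |x|) ^ 2 ≤ d ^ 2 := by gcongr <;> linarith
  have h3 : d ^ 2 ≤ r ^ 2 := by gcongr; linarith
  obtain ⟨a, b⟩ := sqrt_sq_sub_bounds hr (sq_nonneg x) (h1.trans h3)
  obtain ⟨a', b'⟩ := sqrt_sq_sub_bounds hr (sq_nonneg (d - |x|)) (h2.trans h3)
  have e1 : (x ^ 2) ^ 2 / (2 * r ^ 3) ≤ (d ^ 2) ^ 2 / (2 * r ^ 3) := by gcongr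
  have e2 : ((d - |x|) ^ 2) ^ 2 / (2 * r ^ 3) ≤ (d ^ 2) ^ 2 / (2 * r ^ 3) := by gcongr
  have e3 : (d ^ 2) ^ 2 = d ^ 4 := by ring
  rw [e3] at e1 e2
  have e4 : (d ^ 2 - 2 * d * |x|) / (2 * r) = (d - |x|) ^ 2 / (2 * r) - x ^ 2 / (2 * r) := by
    rw [← sub_div, ← sq_abs x]
    ring
  rw [e4, abs_le]
  constructor <;> linarith

theorem volume_tripleRegion {r d : ℝ} (hd : 0 < d) (hdr : d < r / 2) :
    (volume (tripleRegion r d)).toReal =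
      ∫ x in -(d / 2)..d / 2, (√(r ^ 2 - x ^ 2) - √(r ^ 2 - (d - |x|) ^ 2)) := by
  have hslice (x : ℝ) : volume (Prod.mk x ⁻¹' tripleRegion r d) =
      (Set.Ioc (-(d / 2)) (d / 2)).indicator
        (fun x => ENNReal.ofReal (√(r ^ 2 - x ^ 2) - √(r ^ 2 - (d - |x|) ^ 2))) x := by
    rw [tripleRegion_slice hd hdr, Set.indicator_apply]
    split_ifs <;> simp
  rw [Measure.volume_eq_prod, Measure.prod_apply (measurableSet_tripleRegion r d)]
  simp_rw [hslice]
  rw [lintegral_indicator measurableSet_Ioc, intervalIntegral.integral_of_le (by linarith),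
    integral_eq_lintegral_of_nonneg_ae]
  · refine ae_restrict_of_forall_mem measurableSet_Ioc fun x hx => ?_
    have hxd : |x| ≤ d / 2 := abs_le.2 ⟨hx.1.le, hx.2⟩
    refine sub_nonneg.2 (Real.sqrt_le_sqrt (sub_le_sub_left ?_ _))
    rw [← sq_abs x]
    gcongr
    linarith
  · exact Continuous.aestronglyMeasurable (by fun_prop)

theorem integral_abs_symm {a : ℝ} (ha : 0 ≤ a) : ∫ x in -a..a, |x| = a ^ 2 := by
  have hint (u v : ℝ) : IntervalIntegrable (fun x : ℝ => |x|) volume u v :=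
    continuous_abs.intervalIntegrable u v
  have h1 : ∫ x in -a..0, |x| = ∫ x in -a..0, -x :=
    intervalIntegral.integral_congr fun x hx => by
      rw [Set.uIcc_of_le (by linarith)] at hx
      exact abs_of_nonpos hx.2
  have h2 : ∫ x in (0 : ℝ)..a, |x| = ∫ x in (0 : ℝ)..a, x :=
    intervalIntegral.integral_congr fun x hx => by
      rw [Set.uIcc_of_le ha] at hx
      exact abs_of_nonneg hx.1
  rw [← intervalIntegral.integral_add_adjacent_intervals (hint (-a) 0) (hint 0 a), h1, h2,
    intervalIntegral.integral_neg, integral_id, integral_id]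
  ring

theorem volume_tripleRegion_approx {r d : ℝ} (hd : 0 < d) (hdr : d < r / 2) :
    |(volume (tripleRegion r d)).toReal - 1 / r * d ^ 3 / 4| ≤ d ^ 5 / (2 * r ^ 3) := by
  have hr : 0 < r := by linarith
  have hmain : ∫ x in -(d / 2)..d / 2, (d ^ 2 - 2 * d * |x|) / (2 * r) = 1 / r * d ^ 3 / 4 := by
    rw [intervalIntegral.integral_div, intervalIntegral.integral_sub
      (Continuous.intervalIntegrable (by fun_prop) _ _)
      (Continuous.intervalIntegrable (by fun_prop) _ _),
      intervalIntegral.integral_const_mul, integral_abs_symm (by linarith),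
      intervalIntegral.integral_const, smul_eq_mul]
    field_simp
    ring
  rw [volume_tripleRegion hd hdr, ← hmain, ← intervalIntegral.integral_sub
      (Continuous.intervalIntegrable (by fun_prop) _ _)
      (Continuous.intervalIntegrable (by fun_prop) _ _)]
  have h := intervalIntegral.norm_integral_le_of_norm_le_const (a := -(d / 2)) (b := d / 2)
    (C := d ^ 4 / (2 * r ^ 3))
    (f := fun x => √(r ^ 2 - x ^ 2) - √(r ^ 2 - (d - |x|) ^ 2) - (d ^ 2 - 2 * d * |x|) / (2 * r))
    fun x hx => by
      rw [Set.uIoc_of_le (by linarith)] at hx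
      exact sqrt_sub_sqrt_approx hd hdr hx
  rw [Real.norm_eq_abs] at h
  refine h.trans_eq ?_
  rw [show d / 2 - -(d / 2) = d by ring, abs_of_pos hd]
  ring

/-- Theorem 1 of the paper: the area `A(κ,d)` of the set of points `p` in the closed
osculating ball `B` of radius `r = 1/κ` (centered at `(0,-r)`, touching `n = (0,0)` with
unit tangent `ū = (1,0)`), with `‖p - n‖ ≤ r`, such that both translates `p ± d·ū` lie
outside `B`, equals `κ·d³/4 + O(d⁴)` as `d → 0⁺`. -/
theorem area_triple_clique_isBigO (r : ℝ) (hr : 0 < r) (κ : ℝ) (hκ : κ = 1 / r) :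
    (fun d : ℝ =>
        (volume {p : EuclideanSpace ℝ (Fin 2) |
            p ∈ Metric.closedBall (pt 0 (-r)) r ∧
            ‖p - pt 0 0‖ ≤ r ∧
            p + d • pt 1 0 ∉ Metric.closedBall (pt 0 (-r)) r ∧
            p - d • pt 1 0 ∉ Metric.closedBall (pt 0 (-r)) r}).toReal
          - κ * d ^ 3 / 4)
      =O[nhdsWithin 0 (Set.Ioi 0)] (fun d : ℝ => d ^ 4) := by
  subst hκ
  refine IsBigO.of_bound (r / (2 * r ^ 3)) ?_
  filter_upwards [Ioo_mem_nhdsGT (half_pos hr)] with d hd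
  rw [volume_triple_set_eq hr, Real.norm_eq_abs, Real.norm_of_nonneg (by positivity)]
  refine (volume_tripleRegion_approx hd.1 hd.2).trans ?_
  rw [div_mul_eq_mul_div]
  have hd0 : 0 < d := hd.1
  gcongr
  calc d ^ 5 = d * d ^ 4 := by ring
    _ ≤ r * d ^ 4 := by gcongr; linarith [hd.2]
end

section
/- Let r > 0, set κ = 1/r, and let 0 < d < r. In the Euclidean plane ℝ², let B be the closed ball of radius r centered at (0, −r), n = (0,0), and ū = (1,0). Then the two-dimensional Lebesgue measure of the set {p ∈ ℝ² : p ∈ B, ‖p − n‖ ≤ r, p + d·ū ∉ B, p − d·ū ∉ B} equals −(1/κ²)·arcsin(κd) + (2/κ²)·arcsin(κd/2) − d·√(1/κ² − d²) + d·√(1/κ² − d²/4). -/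
open MeasureTheory

/-- Membership in the triple-clique response region, in coordinates: the point lies over the
interval `|x| < d / 2`, between the arc of the circle translated towards it and the circle. -/
lemma triple_clique_region_iff {r d : ℝ} (hr : 0 < r) (hd0 : 0 < d) (hdr : d < r) (x y : ℝ) :
    (x ^ 2 + (y + r) ^ 2 ≤ r ^ 2 ∧ x ^ 2 + y ^ 2 ≤ r ^ 2 ∧
      r ^ 2 < (x + d) ^ 2 + (y + r) ^ 2 ∧ r ^ 2 < (x - d) ^ 2 + (y + r) ^ 2) ↔
    |x| < d / 2 ∧ -r + √(r ^ 2 - (d - |x|) ^ 2) < y ∧ y ≤ -r + √(r ^ 2 - |x| ^ 2) := by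
  have h_abs : (r ^ 2 < (x + d) ^ 2 + (y + r) ^ 2 ∧ r ^ 2 < (x - d) ^ 2 + (y + r) ^ 2) ↔
      r ^ 2 < (d - |x|) ^ 2 + (y + r) ^ 2 := by
    rcases abs_cases x with ⟨h, h'⟩ | ⟨h, h'⟩ <;> rw [h] <;> constructor
    · rintro ⟨_, h2⟩; nlinarith
    · intro h2; constructor <;> nlinarith
    · rintro ⟨h2, _⟩; nlinarith
    · intro h2; constructor <;> nlinarith
  rw [h_abs, ← sq_abs x]
  have ha : 0 ≤ |x| := abs_nonneg x
  generalize |x| = a at ha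
  obtain ⟨v, rfl⟩ : ∃ v, y = v - r := ⟨y + r, by ring⟩
  simp only [sub_add_cancel]
  constructor
  · rintro ⟨h1, h2, h3⟩
    have hv : 0 ≤ v := by nlinarith [sq_nonneg a, sq_nonneg v]
    have had : a < d / 2 := by nlinarith
    have hv0 : 0 < v := by nlinarith
    refine ⟨had, ?_, ?_⟩
    · have := (Real.sqrt_lt' hv0).2 (show r ^ 2 - (d - a) ^ 2 < v ^ 2 by linarith)
      linarith
    · have := Real.le_sqrt_of_sq_le (show v ^ 2 ≤ r ^ 2 - a ^ 2 by linarith)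
      linarith
  · rintro ⟨had, h1, h2⟩
    have h1' : √(r ^ 2 - (d - a) ^ 2) < v := by linarith
    have h2' : v ≤ √(r ^ 2 - a ^ 2) := by linarith
    have hv0 : 0 < v := (Real.sqrt_nonneg _).trans_lt h1'
    have h3 := (Real.sqrt_lt' hv0).1 h1'
    have h4 := (Real.le_sqrt' hv0).1 h2'
    refine ⟨by linarith, ?_, by linarith⟩
    rcases le_or_gt (r / 2) v with hv | hv
    · nlinarith
    · have h5 : r * (r - (d - a)) ≤ (r + (d - a)) * (r - (d - a)) := by nlinarith
      have h6 : r * a ≤ r * (r - (d - a)) := by nlinarith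
      have h7 : r * a ≤ r * (v / 2) := by nlinarith
      have h8 : a ≤ v / 2 := le_of_mul_le_mul_left h7 hr
      nlinarith

/-- Twice the antiderivative of the height of a half circle of radius `r`. -/
lemma hasDerivAt_mul_sqrt_add_arcsin {r x : ℝ} (hr : 0 < r) (h1 : -r < x) (h2 : x < r) :
    HasDerivAt (fun t => t * √(r ^ 2 - t ^ 2) + r ^ 2 * Real.arcsin (t / r))
      (2 * √(r ^ 2 - x ^ 2)) x := by
  have hpos : 0 < r ^ 2 - x ^ 2 := by nlinarith
  have hs : 0 < √(r ^ 2 - x ^ 2) := Real.sqrt_pos.2 hpos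
  have hsq : √(r ^ 2 - x ^ 2) ^ 2 = r ^ 2 - x ^ 2 := Real.sq_sqrt hpos.le
  have e1 : HasDerivAt (fun t : ℝ => r ^ 2 - t ^ 2) (-(2 * x)) x := by
    simpa using (hasDerivAt_pow 2 x).const_sub (r ^ 2)
  have e2 := (hasDerivAt_id x).mul (e1.sqrt hpos.ne')
  have n1 : x / r ≠ -1 := by
    rw [Ne, div_eq_iff hr.ne']; linarith
  have n2 : x / r ≠ 1 := by
    rw [Ne, div_eq_iff hr.ne']; linarith
  have e3 := (((Real.hasDerivAt_arcsin n1 n2).comp x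
    ((hasDerivAt_id x).div_const r)).const_mul (r ^ 2))
  refine (e2.add e3).congr_deriv ?_
  have h4 : √(1 - (x / r) ^ 2) = √(r ^ 2 - x ^ 2) / r := by
    rw [show 1 - (x / r) ^ 2 = (r ^ 2 - x ^ 2) / r ^ 2 by field_simp,
      Real.sqrt_div hpos.le, Real.sqrt_sq hr.le]
  simp only [id, h4]
  field_simp
  rw [hsq]
  ring

lemma integral_circle_sub_translate {r d : ℝ} (hr : 0 < r) (hd0 : 0 < d) (hdr : d < r) :
    ∫ x in (0 : ℝ)..d / 2, (√(r ^ 2 - x ^ 2) - √(r ^ 2 - (d - x) ^ 2)) =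
      (d * √(r ^ 2 - (d / 2) ^ 2) + 2 * r ^ 2 * Real.arcsin (d / 2 / r)
        - d * √(r ^ 2 - d ^ 2) - r ^ 2 * Real.arcsin (d / r)) / 2 := by
  let F : ℝ → ℝ := fun t => t * √(r ^ 2 - t ^ 2) + r ^ 2 * Real.arcsin (t / r)
  have hder : ∀ x ∈ Set.uIcc (0 : ℝ) (d / 2), HasDerivAt (fun x => (F x + F (d - x)) / 2)
      (√(r ^ 2 - x ^ 2) - √(r ^ 2 - (d - x) ^ 2)) x := by
    intro x hx
    rw [Set.uIcc_of_le (by positivity)] at hx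
    have e1 : HasDerivAt F _ x :=
      hasDerivAt_mul_sqrt_add_arcsin hr (by linarith [hx.1]) (by linarith [hx.2])
    have e2 : HasDerivAt F _ (d - x) :=
      hasDerivAt_mul_sqrt_add_arcsin hr (by linarith [hx.2]) (by linarith [hx.1])
    have e3 : HasDerivAt (fun t : ℝ => d - t) (-1) x := (hasDerivAt_id x).const_sub d
    refine ((e1.add (e2.comp x e3)).div_const 2).congr_deriv ?_
    ring
  rw [intervalIntegral.integral_eq_sub_of_hasDerivAt hder
    (Continuous.intervalIntegrable (by fun_prop) _ _)]
  simp only [F, sub_half, sub_zero, zero_div, Real.arcsin_zero]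
  ring

lemma volume_real_triple_clique_prod {r d : ℝ} (hr : 0 < r) (hd0 : 0 < d) (hdr : d < r) :
    (volume {q : ℝ × ℝ | |q.1| < d / 2 ∧ -r + √(r ^ 2 - (d - |q.1|) ^ 2) < q.2 ∧
      q.2 ≤ -r + √(r ^ 2 - |q.1| ^ 2)}).toReal =
      d * √(r ^ 2 - (d / 2) ^ 2) + 2 * r ^ 2 * Real.arcsin (d / 2 / r)
        - d * √(r ^ 2 - d ^ 2) - r ^ 2 * Real.arcsin (d / r) := by
  let h : ℝ → ℝ := fun a => √(r ^ 2 - a ^ 2) - √(r ^ 2 - (d - a) ^ 2)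
  have hmeas : MeasurableSet {q : ℝ × ℝ | |q.1| < d / 2 ∧
      -r + √(r ^ 2 - (d - |q.1|) ^ 2) < q.2 ∧ q.2 ≤ -r + √(r ^ 2 - |q.1| ^ 2)} :=
    MeasurableSet.inter (s₁ := {q : ℝ × ℝ | |q.1| < d / 2})
      (measurableSet_lt (by fun_prop) (by fun_prop))
      (MeasurableSet.inter (s₁ := {q : ℝ × ℝ | -r + √(r ^ 2 - (d - |q.1|) ^ 2) < q.2})
        (s₂ := {q : ℝ × ℝ | q.2 ≤ -r + √(r ^ 2 - |q.1| ^ 2)})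
        (measurableSet_lt (by fun_prop) (by fun_prop))
        (measurableSet_le (by fun_prop) (by fun_prop)))
  have hcont : Continuous fun x : ℝ => h |x| := by fun_prop
  have hslice : ∀ x : ℝ, volume (Prod.mk x ⁻¹' {q : ℝ × ℝ | |q.1| < d / 2 ∧
      -r + √(r ^ 2 - (d - |q.1|) ^ 2) < q.2 ∧ q.2 ≤ -r + √(r ^ 2 - |q.1| ^ 2)}) =
      (Set.Ioo (-(d / 2)) (d / 2)).indicator (fun x => ENNReal.ofReal (h |x|)) x := by
    intro x
    by_cases hx : |x| < d / 2
    · rw [Set.indicator_of_mem (Set.mem_Ioo.2 (abs_lt.1 hx))]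
      simp only [Set.preimage_ofPred_eq, hx, true_and]
      refine (Real.volume_Ioc).trans ?_
      congr 1
      simp only [h]
      ring
    · rw [Set.indicator_of_notMem (fun hm : x ∈ Set.Ioo (-(d / 2)) (d / 2) => hx (abs_lt.2 hm))]
      simp [hx]
  have hnonneg : ∀ x ∈ Set.Ioo (-(d / 2)) (d / 2), 0 ≤ h |x| := by
    intro x hx
    have := abs_lt.2 hx
    have := abs_nonneg x
    exact sub_nonneg.2 (Real.sqrt_le_sqrt (by nlinarith))
  have hright : ∫ x in (0 : ℝ)..d / 2, h |x| = ∫ x in (0 : ℝ)..d / 2, h x := by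
    refine intervalIntegral.integral_congr fun x hx => ?_
    rw [Set.uIcc_of_le (by positivity)] at hx
    simp only [abs_of_nonneg hx.1]
  have hleft : ∫ x in -(d / 2)..0, h |x| = ∫ x in (0 : ℝ)..d / 2, h |x| := by
    simpa using (intervalIntegral.integral_comp_neg (a := 0) (b := d / 2) fun x => h |x|).symm
  have hsymm : ∫ x in -(d / 2)..d / 2, h |x| = 2 * ∫ x in (0 : ℝ)..d / 2, h x := by
    rw [← intervalIntegral.integral_add_adjacent_intervals (b := 0)
      (hcont.intervalIntegrable _ _) (hcont.intervalIntegrable _ _), hleft, hright, two_mul]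
  rw [Measure.volume_eq_prod, Measure.prod_apply hmeas, lintegral_congr hslice,
    lintegral_indicator measurableSet_Ioo,
    ← integral_eq_lintegral_of_nonneg_ae
      ((ae_restrict_iff' measurableSet_Ioo).2 (ae_of_all _ hnonneg))
      hcont.aestronglyMeasurable,
    ← integral_Ioc_eq_integral_Ioo, ← intervalIntegral.integral_of_le (by linarith), hsymm,
    integral_circle_sub_translate hr hd0 hdr]
  ring

lemma norm_sq_eq_add_sq (x : EuclideanSpace ℝ (Fin 2)) : ‖x‖ ^ 2 = x 0 ^ 2 + x 1 ^ 2 := by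
  simp [EuclideanSpace.norm_sq_eq]

/-- The closed-form expression for the area `A(κ,d)` of the triple-clique response region:
points `p` of the closed osculating ball `B` of radius `r = 1/κ` (centered at `(0,-r)`,
touching `n = (0,0)` with unit tangent `ū = (1,0)`), with `‖p - n‖ ≤ r`, whose both
translates `p ± d·ū` lie outside `B`. For `0 < d < r`,
`A(κ,d) = -(1/κ²)·arcsin(κd) + (2/κ²)·arcsin(κd/2) - d·√(1/κ² - d²) + d·√(1/κ² - d²/4)`. -/
theorem area_triple_clique_closed_form (r : ℝ) (hr : 0 < r) (κ : ℝ) (hκ : κ = 1 / r)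
    (d : ℝ) (hd0 : 0 < d) (hdr : d < r) :
    (volume {p : EuclideanSpace ℝ (Fin 2) |
        p ∈ Metric.closedBall (pt 0 (-r)) r ∧
        ‖p - pt 0 0‖ ≤ r ∧
        p + d • pt 1 0 ∉ Metric.closedBall (pt 0 (-r)) r ∧
        p - d • pt 1 0 ∉ Metric.closedBall (pt 0 (-r)) r}).toReal =
      -(1 / κ ^ 2) * Real.arcsin (κ * d) + (2 / κ ^ 2) * Real.arcsin (κ * d / 2)
        - d * Real.sqrt (1 / κ ^ 2 - d ^ 2) + d * Real.sqrt (1 / κ ^ 2 - d ^ 2 / 4) := by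
  have hnorm : ∀ z : EuclideanSpace ℝ (Fin 2), ‖z‖ ≤ r ↔ z 0 ^ 2 + z 1 ^ 2 ≤ r ^ 2 := fun z => by
    rw [← norm_sq_eq_add_sq, sq_le_sq₀ (norm_nonneg _) hr.le]
  let e : EuclideanSpace ℝ (Fin 2) ≃ᵐ ℝ × ℝ :=
    (MeasurableEquiv.toLp 2 (Fin 2 → ℝ)).symm.trans MeasurableEquiv.finTwoArrow
  have he : MeasurePreserving e volume volume :=
    (volume_preserving_finTwoArrow ℝ).comp
      (EuclideanSpace.volume_preserving_symm_measurableEquiv_toLp (Fin 2))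
  have hset : {p : EuclideanSpace ℝ (Fin 2) |
        p ∈ Metric.closedBall (pt 0 (-r)) r ∧
        ‖p - pt 0 0‖ ≤ r ∧
        p + d • pt 1 0 ∉ Metric.closedBall (pt 0 (-r)) r ∧
        p - d • pt 1 0 ∉ Metric.closedBall (pt 0 (-r)) r} =
      e ⁻¹' {q : ℝ × ℝ | |q.1| < d / 2 ∧ -r + √(r ^ 2 - (d - |q.1|) ^ 2) < q.2 ∧
        q.2 ≤ -r + √(r ^ 2 - |q.1| ^ 2)} := by
    ext p
    refine Iff.trans ?_ (triple_clique_region_iff hr hd0 hdr (p 0) (p 1))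
    simp only [Set.mem_ofPred_eq, mem_closedBall_iff_norm, hnorm]
    simp [pt]
  rw [hset, he.measure_preimage_equiv, volume_real_triple_clique_prod hr hd0 hdr, hκ]
  rw [show 1 / (1 / r) ^ 2 = r ^ 2 by field_simp, show 2 / (1 / r) ^ 2 = 2 * r ^ 2 by field_simp,
    show 1 / r * d = d / r by ring, show d / r / 2 = d / 2 / r by ring,
    show d ^ 2 / 4 = (d / 2) ^ 2 by ring]
  ring
end

section
/- Fix κ > 0 and define, for 0 < d < 1/κ, f(d) = −(1/κ²)·arcsin(κd) + (2/κ²)·arcsin(κd/2) − d·√(1/κ² − d²) + d·√(1/κ² − d²/4). Then f(d) − κ·d³/4 = O(d⁴) as d → 0⁺; equivalently, lim_{d→0⁺} f(d)/d³ = κ/4 with the error f(d) − κd³/4 bounded by a constant times d⁴ near 0. -/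
open Asymptotics Filter

/-- The derivative of `arcsin x + x √(1 - x²)` is `2 √(1 - x²)`. -/
theorem hasDerivAt_arcsin_add_mul_sqrt {x : ℝ} (h₁ : -1 < x) (h₂ : x < 1) :
    HasDerivAt (fun y : ℝ => Real.arcsin y + y * Real.sqrt (1 - y ^ 2))
      (2 * Real.sqrt (1 - x ^ 2)) x := by
  have hpos : 0 < 1 - x ^ 2 := by nlinarith
  have hinner : HasDerivAt (fun y : ℝ => 1 - y ^ 2) (-(2 * x)) x := by
    simpa using (hasDerivAt_pow 2 x).const_sub 1
  refine ((Real.hasDerivAt_arcsin h₁.ne' h₂.ne).add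
    ((hasDerivAt_id x).mul (hinner.sqrt hpos.ne'))).congr_deriv ?_
  have hs : 0 < Real.sqrt (1 - x ^ 2) := Real.sqrt_pos.2 hpos
  have hsq : Real.sqrt (1 - x ^ 2) ^ 2 = 1 - x ^ 2 := Real.sq_sqrt hpos.le
  simp only [id]
  field_simp
  linarith

/-- A quantitative second-order expansion of `√(1 - u)`. -/
theorem abs_sqrt_one_sub_sub_le {u : ℝ} (h₀ : 0 ≤ u) (h₁ : u ≤ 1) :
    |Real.sqrt (1 - u) - (1 - u / 2)| ≤ u ^ 2 / 2 := by
  have hs : 0 ≤ Real.sqrt (1 - u) := Real.sqrt_nonneg _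
  have hsq : Real.sqrt (1 - u) ^ 2 = 1 - u := Real.sq_sqrt (by linarith)
  rw [abs_le]
  constructor <;> nlinarith

/-- A quantitative Taylor expansion of `arcsin x + x √(1 - x²)`. -/
theorem abs_arcsin_add_mul_sqrt_sub_le {x : ℝ} (h₀ : 0 ≤ x) (h₁ : x < 1) :
    |Real.arcsin x + x * Real.sqrt (1 - x ^ 2) - (2 * x - x ^ 3 / 3)| ≤ x ^ 5 := by
  have hderiv : ∀ y ∈ Set.Icc 0 x, HasDerivWithinAt
      (fun y : ℝ => Real.arcsin y + y * Real.sqrt (1 - y ^ 2) - (2 * y - y ^ 3 / 3))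
      (2 * Real.sqrt (1 - y ^ 2) - (2 - y ^ 2)) (Set.Icc 0 x) y := by
    intro y hy
    have hpoly : HasDerivAt (fun y : ℝ => 2 * y - y ^ 3 / 3) (2 - y ^ 2) y := by
      refine (((hasDerivAt_id y).const_mul 2).sub
        ((hasDerivAt_pow 3 y).div_const 3)).congr_deriv ?_
      norm_num
    exact ((hasDerivAt_arcsin_add_mul_sqrt (by linarith [hy.1])
      (hy.2.trans_lt h₁)).sub hpoly).hasDerivWithinAt
  have hbound : ∀ y ∈ Set.Icc 0 x,
      ‖2 * Real.sqrt (1 - y ^ 2) - (2 - y ^ 2)‖ ≤ x ^ 4 := by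
    intro y hy
    have hy₁ : y ^ 2 ≤ 1 := pow_le_one₀ hy.1 (hy.2.trans h₁.le)
    have hyx : y ^ 4 ≤ x ^ 4 := pow_le_pow_left₀ hy.1 hy.2 4
    have h := abs_le.1 (abs_sqrt_one_sub_sub_le (sq_nonneg y) hy₁)
    rw [Real.norm_eq_abs, abs_le]
    constructor <;> nlinarith [h.1, h.2]
  have h := (convex_Icc 0 x).norm_image_sub_le_of_norm_hasDerivWithin_le hderiv hbound
    (Set.left_mem_Icc.2 h₀) (Set.right_mem_Icc.2 h₀)
  simp only [Real.norm_eq_abs, sub_zero, abs_of_nonneg h₀] at h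
  norm_num at h
  linarith [show x ^ 4 * x = x ^ 5 by ring]

/-- The explicit error bound behind the Taylor expansion of the area expression. -/
theorem abs_area_sub_le {κ d : ℝ} (hκ : 0 < κ) (h₀ : 0 < d) (h₁ : d < 1 / κ) :
    |-(1 / κ ^ 2) * Real.arcsin (κ * d) + 2 / κ ^ 2 * Real.arcsin (κ * d / 2)
        - d * Real.sqrt (1 / κ ^ 2 - d ^ 2) + d * Real.sqrt (1 / κ ^ 2 - d ^ 2 / 4)
        - κ * d ^ 3 / 4| ≤ 2 * κ ^ 2 * d ^ 4 := by
  have hx₀ : 0 < κ * d := mul_pos hκ h₀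
  have hx₁ : κ * d < 1 := by rwa [lt_div_iff₀ hκ, mul_comm] at h₁
  have hsqrt (t : ℝ) : Real.sqrt (1 / κ ^ 2 - t) = Real.sqrt (1 - κ ^ 2 * t) / κ := by
    rw [show 1 / κ ^ 2 - t = (1 - κ ^ 2 * t) / κ ^ 2 by field_simp,
      Real.sqrt_div' _ (sq_nonneg κ), Real.sqrt_sq hκ.le]
  have hfull := abs_le.1 (abs_arcsin_add_mul_sqrt_sub_le hx₀.le hx₁)
  have hhalf := abs_le.1 (abs_arcsin_add_mul_sqrt_sub_le
    (x := κ * d / 2) (by linarith) (by linarith))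
  have hpow : (κ * d) ^ 5 ≤ (κ * d) ^ 4 := pow_le_pow_of_le_one hx₀.le hx₁.le (by norm_num)
  have hpos : 0 < (κ * d) ^ 5 := pow_pos hx₀ 5
  rw [hsqrt, hsqrt, show κ ^ 2 * d ^ 2 = (κ * d) ^ 2 by ring,
    show κ ^ 2 * (d ^ 2 / 4) = (κ * d / 2) ^ 2 by ring]
  set a := Real.arcsin (κ * d)
  set b := Real.arcsin (κ * d / 2)
  set s := Real.sqrt (1 - (κ * d) ^ 2)
  set t := Real.sqrt (1 - (κ * d / 2) ^ 2)
  have hscale : -(1 / κ ^ 2) * a + 2 / κ ^ 2 * b - d * (s / κ) + d * (t / κ) - κ * d ^ 3 / 4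
      = (2 * (b + κ * d / 2 * t - (2 * (κ * d / 2) - (κ * d / 2) ^ 3 / 3))
        - (a + κ * d * s - (2 * (κ * d) - (κ * d) ^ 3 / 3))) / κ ^ 2 := by
    field_simp
    ring
  have hhalf_pow : (κ * d / 2) ^ 5 = (κ * d) ^ 5 / 32 := by ring
  rw [hhalf_pow] at hhalf
  rw [hscale, abs_div, abs_of_pos (pow_pos hκ 2), div_le_iff₀ (pow_pos hκ 2),
    show 2 * κ ^ 2 * d ^ 4 * κ ^ 2 = 2 * (κ * d) ^ 4 by ring, abs_le]
  constructor <;> linarith [hfull.1, hfull.2, hhalf.1, hhalf.2]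

/-- Taylor expansion of the closed-form area expression
`f(d) = -(1/κ²)·arcsin(κd) + (2/κ²)·arcsin(κd/2) - d·√(1/κ² - d²) + d·√(1/κ² - d²/4)`:
`f(d) - κ·d³/4 = O(d⁴)` as `d → 0⁺`, and equivalently `f(d)/d³ → κ/4` as `d → 0⁺`. -/
theorem closed_form_taylor (κ : ℝ) (hκ : 0 < κ)
    (f : ℝ → ℝ)
    (hf : ∀ d : ℝ, 0 < d → d < 1 / κ →
      f d = -(1 / κ ^ 2) * Real.arcsin (κ * d) + 2 / κ ^ 2 * Real.arcsin (κ * d / 2)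
        - d * Real.sqrt (1 / κ ^ 2 - d ^ 2) + d * Real.sqrt (1 / κ ^ 2 - d ^ 2 / 4)) :
    ((fun d : ℝ => f d - κ * d ^ 3 / 4) =O[nhdsWithin 0 (Set.Ioi 0)] fun d : ℝ => d ^ 4)
      ∧ Tendsto (fun d : ℝ => f d / d ^ 3) (nhdsWithin 0 (Set.Ioi 0)) (nhds (κ / 4)) := by
  have hO : (fun d : ℝ => f d - κ * d ^ 3 / 4) =O[nhdsWithin 0 (Set.Ioi 0)]
      fun d : ℝ => d ^ 4 := by
    refine IsBigO.of_bound (2 * κ ^ 2) ?_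
    filter_upwards [Ioo_mem_nhdsGT (one_div_pos.2 hκ)] with d hd
    rw [hf d hd.1 hd.2, Real.norm_eq_abs, Real.norm_of_nonneg (pow_nonneg hd.1.le 4)]
    exact abs_area_sub_le hκ hd.1 hd.2
  refine ⟨hO, ?_⟩
  have hlim : Tendsto (fun d : ℝ => (f d - κ * d ^ 3 / 4) / d ^ 3)
      (nhdsWithin 0 (Set.Ioi 0)) (nhds 0) :=
    (hO.trans_isLittleO
      ((isLittleO_pow_pow (by norm_num)).mono nhdsWithin_le_nhds)).tendsto_div_nhds_zero
  have hadd := hlim.add_const (κ / 4)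
  rw [zero_add] at hadd
  refine hadd.congr' ?_
  filter_upwards [self_mem_nhdsWithin] with d hd
  have hd₀ : d ≠ 0 := ne_of_gt hd
  field_simp
  ring
end

section
/- Let r > 0 and set κ = 1/r. In ℝ², let B be the closed ball of radius r centered at (0, −r), n = (0,0), ū = (1,0), and for 0 < d < r let A(d) denote the two-dimensional Lebesgue measure of the set {p ∈ ℝ² : p ∈ B, ‖p − n‖ ≤ r, p + d·ū ∉ B, p − d·ū ∉ B}. Then lim_{d→0⁺} 4·A(d)/d³ = κ. -/
open MeasureTheory Filter

/-- The triple-clique response region in Cartesian coordinates. -/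
def cliqueRegion (r d : ℝ) : Set (ℝ × ℝ) :=
  {q | q.1 ^ 2 + (q.2 + r) ^ 2 ≤ r ^ 2 ∧ q.1 ^ 2 + q.2 ^ 2 ≤ r ^ 2 ∧
    r ^ 2 < (q.1 + d) ^ 2 + (q.2 + r) ^ 2 ∧ r ^ 2 < (q.1 - d) ^ 2 + (q.2 + r) ^ 2}

theorem measurableSet_cliqueRegion (r d : ℝ) : MeasurableSet (cliqueRegion r d) := by
  have h (f : ℝ × ℝ → ℝ) (hf : Measurable f) : MeasurableSet {q | f q ≤ r ^ 2} :=
    measurableSet_le hf measurable_const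
  have h' (f : ℝ × ℝ → ℝ) (hf : Measurable f) : MeasurableSet {q | r ^ 2 < f q} :=
    measurableSet_lt measurable_const hf
  exact (h (fun q => q.1 ^ 2 + (q.2 + r) ^ 2) (by fun_prop)).inter
    ((h (fun q => q.1 ^ 2 + q.2 ^ 2) (by fun_prop)).inter
      ((h' (fun q => (q.1 + d) ^ 2 + (q.2 + r) ^ 2) (by fun_prop)).inter
        (h' (fun q => (q.1 - d) ^ 2 + (q.2 + r) ^ 2) (by fun_prop))))

theorem norm_le_iff_coord_sq {r : ℝ} (hr : 0 ≤ r) (p : EuclideanSpace ℝ (Fin 2)) :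
    ‖p‖ ≤ r ↔ p 0 ^ 2 + p 1 ^ 2 ≤ r ^ 2 := by
  rw [EuclideanSpace.norm_eq, Real.sqrt_le_left hr]
  simp

/-- The response region in `EuclideanSpace ℝ (Fin 2)` has the area of `cliqueRegion`. -/
theorem volume_euclidean_eq_cliqueRegion {r : ℝ} (hr : 0 ≤ r) (d : ℝ) :
    volume {p : EuclideanSpace ℝ (Fin 2) |
            p ∈ Metric.closedBall (pt 0 (-r)) r ∧
            ‖p - pt 0 0‖ ≤ r ∧
            p + d • pt 1 0 ∉ Metric.closedBall (pt 0 (-r)) r ∧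
            p - d • pt 1 0 ∉ Metric.closedBall (pt 0 (-r)) r} =
      volume (cliqueRegion r d) := by
  have hmp := (volume_preserving_finTwoArrow ℝ).comp
    (EuclideanSpace.volume_preserving_symm_measurableEquiv_toLp (Fin 2))
  rw [← hmp.measure_preimage (measurableSet_cliqueRegion r d).nullMeasurableSet]
  congr 1
  ext p
  simp only [Set.mem_ofPred_eq, Metric.mem_closedBall, dist_eq_norm, norm_le_iff_coord_sq hr,
    Set.mem_preimage, cliqueRegion, not_le]
  simp [pt]

theorem lintegral_ofReal_tent {d : ℝ} (hd : 0 ≤ d) {c : ℝ} (hc : 0 ≤ c) :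
    ∫⁻ x : ℝ, ENNReal.ofReal (c * (d - 2 * |x|)) = ENNReal.ofReal (c * (d ^ 2 / 2)) := by
  have hsupp : Function.support (fun x : ℝ => ENNReal.ofReal (c * (d - 2 * |x|))) ⊆
      Set.Ioc (-(d / 2)) (d / 2) := by
    intro x hx
    simp only [Function.mem_support, ne_eq, ENNReal.ofReal_eq_zero, not_le] at hx
    have hx' := pos_of_mul_pos_right hx hc
    have := abs_lt.1 (show |x| < d / 2 by linarith)
    exact ⟨this.1, this.2.le⟩
  have hcont : Continuous fun x : ℝ => c * (d - 2 * |x|) := by fun_prop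
  rw [← setLIntegral_eq_of_support_subset hsupp, ← ofReal_integral_eq_lintegral_ofReal,
    ← intervalIntegral.integral_of_le (by linarith)]
  · congr 1
    rw [intervalIntegral.integral_const_mul,
      ← intervalIntegral.integral_add_adjacent_intervals (b := 0)
        (Continuous.intervalIntegrable (by fun_prop) _ _)
        (Continuous.intervalIntegrable (by fun_prop) _ _)]
    have h₁ : ∫ x in (-(d / 2))..0, (d - 2 * |x|) = ∫ x in (-(d / 2))..0, (d + 2 * x) := by
      refine intervalIntegral.integral_congr fun x hx => ?_
      rw [Set.uIcc_of_le (by linarith)] at hx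
      simp only [abs_of_nonpos hx.2]
      ring
    have h₂ : ∫ x in (0 : ℝ)..(d / 2), (d - 2 * |x|) = ∫ x in (0 : ℝ)..(d / 2), (d - 2 * x) := by
      refine intervalIntegral.integral_congr fun x hx => ?_
      rw [Set.uIcc_of_le (by linarith)] at hx
      simp only [abs_of_nonneg hx.1]
    rw [h₁, h₂, intervalIntegral.integral_add (by simp)
      (Continuous.intervalIntegrable (by fun_prop) _ _), intervalIntegral.integral_sub (by simp)
      (Continuous.intervalIntegrable (by fun_prop) _ _)]
    have h (a b : ℝ) : ∫ x in a..b, 2 * x = b ^ 2 - a ^ 2 := by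
      rw [intervalIntegral.integral_const_mul, integral_id]
      ring
    simp only [h, intervalIntegral.integral_const, smul_eq_mul]
    ring
  · exact hcont.integrableOn_Ioc
  · refine (ae_restrict_iff' measurableSet_Ioc).2 (ae_of_all _ fun x hx => ?_)
    have : |x| ≤ d / 2 := abs_le.2 ⟨hx.1.le, hx.2⟩
    exact mul_nonneg hc (by linarith)

theorem cliqueRegion_slice_eq_empty {r d x : ℝ} (hd : 0 < d) (hx : d / 2 ≤ |x|) :
    Prod.mk x ⁻¹' cliqueRegion r d = ∅ := by
  ext y
  simp only [cliqueRegion, Set.mem_preimage, Set.mem_ofPred_eq, Set.mem_empty_iff_false, iff_false]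
  rintro ⟨h₁, -, h₃, h₄⟩
  rcases abs_cases x with ⟨h, -⟩ | ⟨h, -⟩ <;> rw [h] at hx <;> nlinarith

theorem cliqueRegion_slice_eq_Ioc {r d x : ℝ} (hd : 0 < d) (hdr : d < r / 2)
    (hx : |x| < d / 2) :
    Prod.mk x ⁻¹' cliqueRegion r d =
      Set.Ioc (√(r ^ 2 - (d - |x|) ^ 2) - r) (√(r ^ 2 - x ^ 2) - r) := by
  have hx0 := abs_nonneg x
  have hA : 0 ≤ r ^ 2 - (d - |x|) ^ 2 := by nlinarith
  have hhalf : r / 2 ≤ √(r ^ 2 - (d - |x|) ^ 2) := Real.le_sqrt_of_sq_le (by nlinarith)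
  ext y
  simp only [cliqueRegion, Set.mem_preimage, Set.mem_ofPred_eq, Set.mem_Ioc, sub_lt_iff_lt_add,
    le_sub_iff_add_le]
  constructor
  · rintro ⟨h₁, h₂, h₃, h₄⟩
    have hy : 0 ≤ y + r := by
      by_contra! hneg
      nlinarith [sq_nonneg x]
    refine ⟨(Real.sqrt_lt hA hy).2 ?_, Real.le_sqrt_of_sq_le (by linarith)⟩
    rcases abs_cases x with ⟨h, -⟩ | ⟨h, -⟩ <;> rw [h] <;> nlinarith
  · rintro ⟨hl, hu⟩
    have hy : r / 2 ≤ y + r := hhalf.trans hl.le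
    have hl' := (Real.sqrt_lt hA (by linarith)).1 hl
    have hu' := (Real.le_sqrt' (by linarith)).1 hu
    refine ⟨by linarith, by nlinarith, ?_, ?_⟩ <;>
      rcases abs_cases x with ⟨h, -⟩ | ⟨h, -⟩ <;> rw [h] at hl' hx0 <;> nlinarith

/-- The length of a vertical slice of the region, for `|x| < d / 2`. -/
theorem sqrt_sub_sqrt_mem_Icc {r d x : ℝ} (hd : 0 < d) (hdr : d < r / 2) (hx : |x| < d / 2) :
    √(r ^ 2 - x ^ 2) - √(r ^ 2 - (d - |x|) ^ 2) ∈
      Set.Icc (d / (2 * r) * (d - 2 * |x|)) (d / (2 * √(r ^ 2 - d ^ 2)) * (d - 2 * |x|)) := by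
  have hx0 := abs_nonneg x
  have hr : 0 < r := by linarith
  have hs : 0 < √(r ^ 2 - d ^ 2) := Real.sqrt_pos.2 (by nlinarith)
  have hxx : x ^ 2 = |x| ^ 2 := (sq_abs x).symm
  have ha : √(r ^ 2 - x ^ 2) ≤ r := Real.sqrt_le_iff.2 ⟨hr.le, by nlinarith⟩
  have hb : √(r ^ 2 - (d - |x|) ^ 2) ≤ r :=
    Real.sqrt_le_iff.2 ⟨hr.le, by nlinarith⟩
  have ha' : √(r ^ 2 - d ^ 2) ≤ √(r ^ 2 - x ^ 2) := Real.sqrt_le_sqrt (by nlinarith)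
  have hb' : √(r ^ 2 - d ^ 2) ≤ √(r ^ 2 - (d - |x|) ^ 2) := Real.sqrt_le_sqrt (by nlinarith)
  have hsa := Real.sq_sqrt (show 0 ≤ r ^ 2 - x ^ 2 by nlinarith)
  have hsb := Real.sq_sqrt (show 0 ≤ r ^ 2 - (d - |x|) ^ 2 by nlinarith)
  set a := √(r ^ 2 - x ^ 2)
  set b := √(r ^ 2 - (d - |x|) ^ 2)
  set s := √(r ^ 2 - d ^ 2)
  have hprod : (a - b) * (a + b) = d * (d - 2 * |x|) := by nlinarith
  have hdx : 0 < d * (d - 2 * |x|) := mul_pos hd (by linarith)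
  have hab : 0 < a - b := pos_of_mul_pos_left (hprod ▸ hdx) (by linarith)
  constructor
  · rw [div_mul_eq_mul_div, div_le_iff₀ (by linarith), ← hprod]
    exact mul_le_mul_of_nonneg_left (by linarith) hab.le
  · rw [div_mul_eq_mul_div, le_div_iff₀ (by linarith), ← hprod]
    exact mul_le_mul_of_nonneg_left (by linarith) hab.le

theorem volume_cliqueRegion_slice_mem_Icc {r d : ℝ} (hd : 0 < d) (hdr : d < r / 2) (x : ℝ) :
    volume (Prod.mk x ⁻¹' cliqueRegion r d) ∈
      Set.Icc (ENNReal.ofReal (d / (2 * r) * (d - 2 * |x|)))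
        (ENNReal.ofReal (d / (2 * √(r ^ 2 - d ^ 2)) * (d - 2 * |x|))) := by
  rcases le_or_gt (d / 2) |x| with hx | hx
  · rw [cliqueRegion_slice_eq_empty hd hx, measure_empty]
    refine ⟨(ENNReal.ofReal_eq_zero.2 ?_).le, zero_le⟩
    exact mul_nonpos_of_nonneg_of_nonpos (div_nonneg hd.le (by linarith)) (by linarith)
  · rw [cliqueRegion_slice_eq_Ioc hd hdr hx, Real.volume_Ioc, sub_sub_sub_cancel_right]
    have h := sqrt_sub_sqrt_mem_Icc hd hdr hx
    exact ⟨ENNReal.ofReal_le_ofReal h.1, ENNReal.ofReal_le_ofReal h.2⟩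

theorem volume_cliqueRegion_mem_Icc {r d : ℝ} (hd : 0 < d) (hdr : d < r / 2) :
    (volume (cliqueRegion r d)).toReal ∈
      Set.Icc (d / (2 * r) * (d ^ 2 / 2)) (d / (2 * √(r ^ 2 - d ^ 2)) * (d ^ 2 / 2)) := by
  have hr : 0 < r := by linarith
  have hl : 0 ≤ d / (2 * r) := by positivity
  have hu : 0 ≤ d / (2 * √(r ^ 2 - d ^ 2)) := by positivity
  have hle : ENNReal.ofReal (d / (2 * r) * (d ^ 2 / 2)) ≤ volume (cliqueRegion r d) := by
    rw [Measure.volume_eq_prod, Measure.prod_apply (measurableSet_cliqueRegion r d),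
      ← lintegral_ofReal_tent hd.le hl]
    exact lintegral_mono fun x => (volume_cliqueRegion_slice_mem_Icc hd hdr x).1
  have hge : volume (cliqueRegion r d) ≤
      ENNReal.ofReal (d / (2 * √(r ^ 2 - d ^ 2)) * (d ^ 2 / 2)) := by
    rw [Measure.volume_eq_prod, Measure.prod_apply (measurableSet_cliqueRegion r d),
      ← lintegral_ofReal_tent hd.le hu]
    exact lintegral_mono fun x => (volume_cliqueRegion_slice_mem_Icc hd hdr x).2
  exact ⟨(ENNReal.ofReal_le_iff_le_toReal (hge.trans_lt ENNReal.ofReal_lt_top).ne).1 hle,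
    ENNReal.toReal_le_of_le_ofReal (by positivity) hge⟩

/-- Corollary of Theorem 1: with `A(d)` the area of the triple-clique response region in
the closed osculating ball `B` of radius `r = 1/κ` (centered at `(0,-r)`, touching
`n = (0,0)` with unit tangent `ū = (1,0)`), namely the set of `p ∈ B` with `‖p - n‖ ≤ r`
and both translates `p ± d·ū` outside `B`, one has `4·A(d)/d³ → κ` as `d → 0⁺`. -/
theorem area_triple_clique_limit (r : ℝ) (hr : 0 < r) (κ : ℝ) (hκ : κ = 1 / r) :
    Tendsto
      (fun d : ℝ =>
        4 * (volume {p : EuclideanSpace ℝ (Fin 2) |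
            p ∈ Metric.closedBall (pt 0 (-r)) r ∧
            ‖p - pt 0 0‖ ≤ r ∧
            p + d • pt 1 0 ∉ Metric.closedBall (pt 0 (-r)) r ∧
            p - d • pt 1 0 ∉ Metric.closedBall (pt 0 (-r)) r}).toReal / d ^ 3)
      (nhdsWithin 0 (Set.Ioi 0)) (nhds κ) := by
  subst hκ
  simp only [volume_euclidean_eq_cliqueRegion hr.le]
  have hlim : Tendsto (fun d : ℝ => 1 / √(r ^ 2 - d ^ 2)) (nhdsWithin 0 (Set.Ioi 0))
      (nhds (1 / r)) := by
    have hcont : ContinuousAt (fun d : ℝ => 1 / √(r ^ 2 - d ^ 2)) 0 := by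
      refine ContinuousAt.div (by fun_prop) (by fun_prop) ?_
      exact (Real.sqrt_pos.2 (by simpa using by positivity)).ne'
    have h := hcont.tendsto
    simp only [ne_eq, OfNat.ofNat_ne_zero, not_false_eq_true, zero_pow, sub_zero,
      Real.sqrt_sq hr.le] at h
    exact h.mono_left nhdsWithin_le_nhds
  have hsmall : ∀ᶠ d : ℝ in nhdsWithin 0 (Set.Ioi 0), d ∈ Set.Ioo 0 (r / 2) :=
    Ioo_mem_nhdsGT (by linarith)
  refine tendsto_of_tendsto_of_tendsto_of_le_of_le' tendsto_const_nhds hlim ?_ ?_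
  · filter_upwards [hsmall] with d ⟨hd, hdr⟩
    rw [le_div_iff₀ (by positivity)]
    have h := (volume_cliqueRegion_mem_Icc hd hdr).1
    calc 1 / r * d ^ 3 = 4 * (d / (2 * r) * (d ^ 2 / 2)) := by field_simp; norm_num
      _ ≤ _ := by linarith
  · filter_upwards [hsmall] with d ⟨hd, hdr⟩
    have hs : 0 < √(r ^ 2 - d ^ 2) := Real.sqrt_pos.2 (by nlinarith)
    rw [div_le_iff₀ (by positivity)]
    have h := (volume_cliqueRegion_mem_Icc hd hdr).2
    calc _ ≤ 4 * (d / (2 * √(r ^ 2 - d ^ 2)) * (d ^ 2 / 2)) := by linarith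
      _ = 1 / √(r ^ 2 - d ^ 2) * d ^ 3 := by field_simp; norm_num
end
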